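/- Let n, N, q ≥ 1 be integers, let c > 0 and ε > 0 be reals, let i ∈ [n], and let C : {±1}^n → {±1}^N. Suppose p is a probability distribution on the subsets of [N] of size at most q, and for each such subset Q there is a function f_Q : {±1}^N → [-1,1] depending only on the coordinates in Q, such that: (smoothness) for every j ∈ [N], ∑_{Q : j ∈ Q} p(Q) ≤ c/N; and (correctness) for every x ∈ {±1}^n, x_i · ∑_Q p(Q)·f_Q(C(x)) ≥ 2ε. Then there exists a family M of pairwise disjoint nonempty subsets of [N], each of size at most q, with |M| ≥ εN/(cq), and for every S ∈ M a sign a_S ∈ {±1}, such that 2^{-n}·∑_{x ∈ {±1}^n} a_S · x_i · ∏_{j ∈ S} C(x)_j ≥ ε/2^q. -/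

import Mathlib

/-- Interpret a Boolean as an element of `{±1} ⊆ ℝ`. -/
def pmOne (b : Bool) : ℝ := if b then 1 else -1

lemma abs_pmOne (b : Bool) : |pmOne b| = 1 := by
  cases b <;> simp [pmOne]

lemma pmOne_not (b : Bool) : pmOne (!b) = -pmOne b := by
  cases b <;> simp [pmOne]

lemma sum_pmOne_apply {ι : Type*} [Fintype ι] [DecidableEq ι] (i : ι) :
    ∑ x : ι → Bool, pmOne (x i) = 0 := by
  have hinv : Function.Involutive fun x : ι → Bool => Function.update x i (!x i) := fun x => by
    simp
  have h := hinv.toPerm.sum_comp Finset.univ (fun x : ι → Bool => pmOne (x i)) (by simp)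
  simp only [Function.Involutive.coe_toPerm, Function.update_self, pmOne_not,
    Finset.sum_neg_distrib] at h
  linarith

/-- If a weight `w` correlates weakly with every parity on a subset of `Q`, then it correlates
weakly with every bounded function of the coordinates in `Q`. -/
lemma abs_sum_mul_lt_of_abs_sum_parity_lt {X ι : Type*} [Fintype X] [DecidableEq ι]
    (C : X → ι → Bool) (δ : ℝ) (Q : Finset ι) (w : X → ℝ) (f : (ι → Bool) → ℝ)
    (hf : ∀ y, |f y| ≤ 1) (hdep : ∀ y y', (∀ j ∈ Q, y j = y' j) → f y = f y')
    (hw : ∀ S ⊆ Q, |∑ x, w x * ∏ j ∈ S, pmOne (C x j)| < δ) :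
    |∑ x, w x * f (C x)| < 2 ^ Q.card * δ := by
  induction Q using Finset.induction_on generalizing w f with
  | empty =>
    have h := hw ∅ subset_rfl
    have hconst : ∀ x, f (C x) = f fun _ => true := fun x => hdep _ _ (by simp)
    simp only [Finset.prod_empty, mul_one] at h
    simp only [hconst, ← Finset.sum_mul, abs_mul, Finset.card_empty, pow_zero, one_mul]
    exact (mul_le_of_le_one_right (abs_nonneg _) (hf _)).trans_lt h
  | insert a Q ha ih =>
    let f₁ : (ι → Bool) → ℝ := fun y => f (Function.update y a true)
    let f₀ : (ι → Bool) → ℝ := fun y => f (Function.update y a false)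
    have hupd : ∀ b y y', (∀ j ∈ Q, y j = y' j) →
        f (Function.update y a b) = f (Function.update y' a b) := by
      intro b y y' h
      refine hdep _ _ fun j hj => ?_
      rcases eq_or_ne j a with rfl | hja
      · simp
      · simpa [hja] using h j (Finset.mem_of_mem_insert_of_ne hj hja)
    have hsplit : ∀ y, f y = (f₁ y + f₀ y) / 2 + pmOne (y a) * ((f₁ y - f₀ y) / 2) := by
      intro y
      have hy : f y = f (Function.update y a (y a)) := by simp
      rw [hy]
      cases y a <;> simp [pmOne, f₁, f₀] <;> ring
    have hb₁ : ∀ y, |f₁ y| ≤ 1 := fun y => hf _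
    have hb₀ : ∀ y, |f₀ y| ≤ 1 := fun y => hf _
    have hmean := ih w (fun y => (f₁ y + f₀ y) / 2)
      (fun y => by
        have h₁ := abs_le.1 (hb₁ y)
        have h₀ := abs_le.1 (hb₀ y)
        exact abs_le.2 ⟨by linarith, by linarith⟩)
      (fun y y' h => by simp only [f₁, f₀, hupd _ y y' h])
      (fun S hS => hw S (hS.trans (Finset.subset_insert a Q)))
    have hdiff := ih (fun x => w x * pmOne (C x a)) (fun y => (f₁ y - f₀ y) / 2)
      (fun y => by
        have h₁ := abs_le.1 (hb₁ y)
        have h₀ := abs_le.1 (hb₀ y)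
        exact abs_le.2 ⟨by linarith, by linarith⟩)
      (fun y y' h => by simp only [f₁, f₀, hupd _ y y' h])
      (fun S hS => by
        have h := hw (insert a S) (Finset.insert_subset_insert a hS)
        simpa only [Finset.prod_insert (fun h => ha (hS h)), mul_assoc] using h)
    have hsum : ∑ x, w x * f (C x) = ∑ x, w x * ((f₁ (C x) + f₀ (C x)) / 2) +
        ∑ x, w x * pmOne (C x a) * ((f₁ (C x) - f₀ (C x)) / 2) := by
      rw [← Finset.sum_add_distrib]
      refine Finset.sum_congr rfl fun x _ => ?_
      rw [hsplit (C x)]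
      ring
    rw [hsum, Finset.card_insert_of_notMem ha, pow_succ]
    refine (abs_add_le _ _).trans_lt ?_
    linarith

/-- A reverse Markov inequality for a finite probability distribution. -/
lemma le_sum_filter_of_two_mul_le_sum {α : Type*} [Fintype α] (p g : α → ℝ) (ε : ℝ)
    [DecidablePred fun a => ε ≤ g a] (hε : 0 ≤ ε) (hp0 : ∀ a, 0 ≤ p a) (hpsum : ∑ a, p a = 1)
    (hg : ∀ a, g a ≤ 1) (h : 2 * ε ≤ ∑ a, p a * g a) :
    ε ≤ ∑ a with ε ≤ g a, p a := by
  have hle : ∑ a, p a * g a ≤ ∑ a, ((if ε ≤ g a then p a else 0) + p a * ε) := by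
    refine Finset.sum_le_sum fun a _ => ?_
    split_ifs with ha
    · nlinarith [hp0 a, hg a]
    · nlinarith [hp0 a]
  rw [Finset.sum_add_distrib, ← Finset.sum_mul, hpsum, ← Finset.sum_filter] at hle
  linarith

/-- A set of weight `ε` of finsets of size at most `q`, each containing a nonempty set with
property `P`, in a distribution whose point marginals are at most `r`, forces a large pairwise
disjoint family of nonempty sets with property `P`. -/
lemma exists_pairwise_disjoint_family {ι : Type*} [Fintype ι] [DecidableEq ι]
    (p : Finset ι → ℝ) (hp0 : ∀ Q, 0 ≤ p Q) (r ε : ℝ) (hr : 0 ≤ r) (q : ℕ)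
    (hsmooth : ∀ j, ∑ Q with j ∈ Q, p Q ≤ r) (P : Finset ι → Prop)
    (hPcard : ∀ S, P S → S.Nonempty ∧ S.card ≤ q)
    (G : Finset (Finset ι)) (hG : ∀ Q ∈ G, p Q ≠ 0 → ∃ S ⊆ Q, P S)
    (hGsum : ε ≤ ∑ Q ∈ G, p Q) :
    ∃ M : Finset (Finset ι), (∀ S ∈ M, P S) ∧
      (∀ S ∈ M, ∀ S' ∈ M, S ≠ S' → Disjoint S S') ∧ ε ≤ M.card * q * r := by
  classical
  obtain ⟨M, hM⟩ := Set.Finite.exists_maximal (Set.toFinite {M : Finset (Finset ι) |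
    (∀ S ∈ M, P S) ∧ ∀ S ∈ M, ∀ S' ∈ M, S ≠ S' → Disjoint S S'}) ⟨∅, by simp⟩
  obtain ⟨⟨hMP, hMdisj⟩, hmax⟩ := hM
  refine ⟨M, hMP, hMdisj, ?_⟩
  let V := M.biUnion id
  have hV : (V.card : ℝ) ≤ M.card * q := by
    exact_mod_cast Finset.card_biUnion_le_card_mul M id q fun S hS => (hPcard S (hMP S hS)).2
  have hmeet : ∀ Q ∈ G, p Q ≠ 0 → ∃ j ∈ V, j ∈ Q := by
    intro Q hQ hpQ
    obtain ⟨S, hSQ, hPS⟩ := hG Q hQ hpQ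
    by_contra! hcon
    have hdisj : ∀ T ∈ M, Disjoint S T := fun T hT => Finset.disjoint_left.2 fun j hjS hjT =>
      hcon j (Finset.mem_biUnion.2 ⟨T, hT, hjT⟩) (hSQ hjS)
    have hSM : S ∈ M := by
      refine hmax (y := insert S M) ⟨?_, ?_⟩ (Finset.subset_insert S M)
        (Finset.mem_insert_self S M)
      · simpa [hPS] using hMP
      · intro A hA B hB hAB
        rcases Finset.mem_insert.1 hA with rfl | hAM <;>
          rcases Finset.mem_insert.1 hB with rfl | hBM
        · exact absurd rfl hAB
        · exact hdisj B hBM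
        · exact (hdisj A hAM).symm
        · exact hMdisj A hAM B hBM hAB
    exact (hPcard S hPS).1.ne_empty (Finset.disjoint_self_iff_empty S |>.1 (hdisj S hSM))
  calc ε ≤ ∑ Q ∈ G, p Q := hGsum
    _ ≤ ∑ Q ∈ G, ∑ j ∈ V, (if j ∈ Q then p Q else 0) := by
      refine Finset.sum_le_sum fun Q hQ => ?_
      have hnonneg : ∀ j ∈ V, 0 ≤ if j ∈ Q then p Q else 0 := fun j _ => by
        split_ifs
        exacts [hp0 Q, le_rfl]
      by_cases hpQ : p Q = 0
      · simpa only [hpQ] using Finset.sum_nonneg hnonneg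
      · obtain ⟨j, hjV, hjQ⟩ := hmeet Q hQ hpQ
        simpa only [if_pos hjQ] using Finset.single_le_sum hnonneg hjV
    _ ≤ ∑ Q, ∑ j ∈ V, (if j ∈ Q then p Q else 0) :=
      Finset.sum_le_univ_sum_of_nonneg fun Q => Finset.sum_nonneg fun j _ => by
        split_ifs
        exacts [hp0 Q, le_rfl]
    _ = ∑ j ∈ V, ∑ Q with j ∈ Q, p Q := by
      simp only [Finset.sum_filter]
      exact Finset.sum_comm
    _ ≤ ∑ _j ∈ V, r := Finset.sum_le_sum fun j _ => hsmooth j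
    _ = V.card * r := by rw [Finset.sum_const, nsmul_eq_mul]
    _ ≤ M.card * q * r := mul_le_mul_of_nonneg_right hV hr

/-- Matching-with-parities lemma for smooth codes: a smooth decoder for bit `i` yields
at least `εN/(cq)` pairwise disjoint nonempty sets `S` of size at most `q`, each with a
sign `a_S ∈ {±1}` such that the (possibly negated) parity `∏_{j∈S} C(x)_j` predicts
`x_i` with bias at least `ε/2^q`. -/
theorem smooth_code_matching_parities (n N q : ℕ) (hn : 1 ≤ n) (hN : 1 ≤ N) (hq : 1 ≤ q)
    (c ε : ℝ) (hc : 0 < c) (hε : 0 < ε) (i : Fin n)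
    (C : (Fin n → Bool) → (Fin N → Bool))
    (p : Finset (Fin N) → ℝ)
    (hp0 : ∀ Q, 0 ≤ p Q)
    (hpsupp : ∀ Q : Finset (Fin N), q < Q.card → p Q = 0)
    (hpsum : ∑ Q : Finset (Fin N), p Q = 1)
    (f : Finset (Fin N) → (Fin N → Bool) → ℝ)
    (hfbd : ∀ Q y, -1 ≤ f Q y ∧ f Q y ≤ 1)
    (hfdep : ∀ Q y y', (∀ j ∈ Q, y j = y' j) → f Q y = f Q y')
    (hsmooth : ∀ j : Fin N,
      ∑ Q ∈ Finset.univ.filter (fun Q : Finset (Fin N) => j ∈ Q), p Q ≤ c / N)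
    (hcorrect : ∀ x : Fin n → Bool,
      pmOne (x i) * ∑ Q : Finset (Fin N), p Q * f Q (C x) ≥ 2 * ε) :
    ∃ M : Finset (Finset (Fin N)),
      (∀ S ∈ M, S.Nonempty) ∧
      (∀ S ∈ M, S.card ≤ q) ∧
      (∀ S ∈ M, ∀ S' ∈ M, S ≠ S' → Disjoint S S') ∧
      (M.card : ℝ) ≥ ε * N / (c * q) ∧
      (∀ S ∈ M, ∃ a : ℝ, (a = 1 ∨ a = -1) ∧
        (2 ^ n : ℝ)⁻¹ * ∑ x : Fin n → Bool,
            a * pmOne (x i) * ∏ j ∈ S, pmOne (C x j) ≥ ε / 2 ^ q) := by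
  let w : (Fin n → Bool) → ℝ := fun x => (2 ^ n : ℝ)⁻¹ * pmOne (x i)
  let bias : Finset (Fin N) → ℝ := fun S => ∑ x, w x * ∏ j ∈ S, pmOne (C x j)
  let g : Finset (Fin N) → ℝ := fun Q => ∑ x, w x * f Q (C x)
  have havg : ∀ t : ℝ, ∑ _x : Fin n → Bool, (2 ^ n : ℝ)⁻¹ * t = t := fun t => by
    simp
  have hg : ∀ Q, g Q ≤ 1 := by
    intro Q
    rw [← havg 1]
    refine Finset.sum_le_sum fun x _ => ?_
    rw [mul_assoc]
    refine mul_le_mul_of_nonneg_left ((le_abs_self _).trans ?_) (by positivity)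
    rw [abs_mul, abs_pmOne, one_mul]
    exact abs_le.2 (hfbd Q (C x))
  have hmean : 2 * ε ≤ ∑ Q, p Q * g Q := by
    calc 2 * ε = ∑ _x : Fin n → Bool, (2 ^ n : ℝ)⁻¹ * (2 * ε) := (havg _).symm
      _ ≤ ∑ x : Fin n → Bool, (2 ^ n : ℝ)⁻¹ * (pmOne (x i) * ∑ Q, p Q * f Q (C x)) :=
        Finset.sum_le_sum fun x _ => mul_le_mul_of_nonneg_left (hcorrect x) (by positivity)
      _ = ∑ Q, p Q * g Q := by
        simp only [g, w, Finset.mul_sum]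
        rw [Finset.sum_comm]
        refine Finset.sum_congr rfl fun Q _ => Finset.sum_congr rfl fun x _ => ?_
        ring
  have hempty : bias ∅ = 0 := by
    simp [bias, w, ← Finset.mul_sum, sum_pmOne_apply]
  have hδ : 0 < ε / 2 ^ q := by positivity
  classical
  obtain ⟨M, hMP, hMdisj, hMcard⟩ := exists_pairwise_disjoint_family p hp0 (c / N) ε
    (by positivity) q hsmooth (fun S => (S.Nonempty ∧ S.card ≤ q) ∧ ε / 2 ^ q ≤ |bias S|)
    (fun S hS => hS.1) {Q | ε ≤ g Q}
    (by
      intro Q hQ hpQ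
      have hQq : Q.card ≤ q := not_lt.1 fun h => hpQ (hpsupp Q h)
      by_contra! hcon
      have hsmall : ∀ S ⊆ Q, |bias S| < ε / 2 ^ q := by
        intro S hS
        rcases S.eq_empty_or_nonempty with rfl | hne
        · rwa [hempty, abs_zero]
        · exact hcon S hS ⟨hne, (Finset.card_le_card hS).trans hQq⟩
      have hlt : |g Q| < 2 ^ Q.card * (ε / 2 ^ q) :=
        abs_sum_mul_lt_of_abs_sum_parity_lt C _ Q w (f Q) (fun y => abs_le.2 (hfbd Q y))
          (hfdep Q) hsmall
      have hle : 2 ^ Q.card * (ε / 2 ^ q) ≤ ε := by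
        calc (2 : ℝ) ^ Q.card * (ε / 2 ^ q) ≤ 2 ^ q * (ε / 2 ^ q) :=
              mul_le_mul_of_nonneg_right (pow_le_pow_right₀ one_le_two hQq) hδ.le
          _ = ε := by field_simp
      have hQε : ε ≤ g Q := by simpa using hQ
      linarith [le_abs_self (g Q)])
    (le_sum_filter_of_two_mul_le_sum p g ε hε.le hp0 hpsum hg hmean)
  refine ⟨M, fun S hS => (hMP S hS).1.1, fun S hS => (hMP S hS).1.2, hMdisj, ?_, ?_⟩
  · have hN' : (0 : ℝ) < N := by exact_mod_cast hN
    have hq' : (0 : ℝ) < q := by exact_mod_cast hq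
    rw [ge_iff_le, div_le_iff₀ (by positivity)]
    calc ε * N ≤ M.card * q * (c / N) * N := mul_le_mul_of_nonneg_right hMcard hN'.le
      _ = M.card * (c * q) := by field_simp
  · intro S hS
    have hsign : ∀ a : ℝ, (2 ^ n : ℝ)⁻¹ * ∑ x : Fin n → Bool,
        a * pmOne (x i) * ∏ j ∈ S, pmOne (C x j) = a * bias S := by
      intro a
      simp only [bias, w, Finset.mul_sum]
      exact Finset.sum_congr rfl fun x _ => by ring
    have hbias := (hMP S hS).2
    rcases le_abs.1 hbias with h | h
    · exact ⟨1, Or.inl rfl, by rw [hsign]; linarith⟩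
    · exact ⟨-1, Or.inr rfl, by rw [hsign]; linarith⟩
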